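/- With notation as in the construction of Ω = Ω₁ ∪ Ω₂ for two digroups (A₁,e₁), (A₂,e₂), the digroup (Ω, e₁) together with the natural embeddings of A₁ and A₂ is a free product of (A₁,e₁) and (A₂,e₂): for any digroup (G,e) and digroup homomorphisms fᵢ : Aᵢ → G (i=1,2) there is a unique digroup homomorphism φ : Ω → G extending both. -/

import Mathlib

/-- A disemigroup: two associative operations `l` (⊢) and `r` (⊣)
satisfying the dialgebra axioms. -/
structure DisemigroupStruct (D : Type) where
  l : D → D → D
  r : D → D → D
  l_assoc : ∀ a b c, l (l a b) c = l a (l b c)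
  r_assoc : ∀ a b c, r (r a b) c = r a (r b c)
  ax1 : ∀ a b c, r a (l b c) = r a (r b c)
  ax2 : ∀ a b c, l (r a b) c = l (l a b) c
  ax3 : ∀ a b c, l a (r b c) = r (l a b) c

/-- A digroup: a disemigroup with a bar-unit `one` and inverses. -/
structure DigroupStruct (D : Type) extends DisemigroupStruct D where
  one : D
  inv : D → D
  one_l : ∀ a, l one a = a
  r_one : ∀ a, r a one = a
  l_inv : ∀ a, l a (inv a) = one
  inv_r : ∀ a, r (inv a) a = one

def IsDisemigroupHom {A B : Type} (G : DisemigroupStruct A) (H : DisemigroupStruct B)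
    (f : A → B) : Prop :=
  (∀ a b, f (G.l a b) = H.l (f a) (f b)) ∧ (∀ a b, f (G.r a b) = H.r (f a) (f b))

def IsDigroupHom {A B : Type} (G : DigroupStruct A) (H : DigroupStruct B)
    (f : A → B) : Prop :=
  (∀ a b, f (G.l a b) = H.l (f a) (f b)) ∧ (∀ a b, f (G.r a b) = H.r (f a) (f b)) ∧
  f G.one = H.one

/-- The group part J = {a ⊢ 1 : a ∈ G}. -/
def groupPart {A : Type} (G : DigroupStruct A) : Set A := {a | ∃ b, a = G.l b G.one}

/-- The halo: the set of bar-units. -/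
def halo {A : Type} (G : DigroupStruct A) : Set A := {e | ∀ a, G.l e a = a ∧ G.r a e = a}

/-- `(D, g1, g2)` is a free product (coproduct) of the digroups `D1`, `D2`. -/
def IsFreeProduct {A1 A2 B : Type} (D1 : DigroupStruct A1) (D2 : DigroupStruct A2)
    (D : DigroupStruct B) (g1 : A1 → B) (g2 : A2 → B) : Prop :=
  IsDigroupHom D1 D g1 ∧ IsDigroupHom D2 D g2 ∧
  ∀ {C : Type} (G : DigroupStruct C) (f1 : A1 → C) (f2 : A2 → C),
    IsDigroupHom D1 G f1 → IsDigroupHom D2 G f2 →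
    ∃! φ : B → C, IsDigroupHom D G φ ∧ φ ∘ g1 = f1 ∧ φ ∘ g2 = f2

open scoped Classical

section OmegaConstruction

variable {D1 D2 : Type} (A1 : DigroupStruct D1) (A2 : DigroupStruct D2)

/-- `x` is the unit of its factor. -/
def unitL : D1 ⊕ D2 → Prop
  | Sum.inl a => a = A1.one
  | Sum.inr a => a = A2.one

/-- `x` lies in the group part of its factor. -/
def inJ : D1 ⊕ D2 → Prop
  | Sum.inl a => a ∈ groupPart A1
  | Sum.inr a => a ∈ groupPart A2

/-- Two letters lie in the same factor. -/
def sameF {D1 D2 : Type} (x y : D1 ⊕ D2) : Prop := x.isLeft = y.isLeft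

/-- `x ↦ x^♯ = x ⊢ e` computed in its factor. -/
def sharp : D1 ⊕ D2 → D1 ⊕ D2
  | Sum.inl a => Sum.inl (A1.l a A1.one)
  | Sum.inr a => Sum.inr (A2.l a A2.one)

/-- The letter map inducing `τ : A* → J*`: fixes `J` and sends `x ∉ J` to `x^♯`. -/
noncomputable def tauL (x : D1 ⊕ D2) : D1 ⊕ D2 :=
  if inJ A1 A2 x then x else sharp A1 A2 x

/-- Same-factor product `x ⊢ y` of letters (junk value on mixed factors). -/
def lmulL : D1 ⊕ D2 → D1 ⊕ D2 → D1 ⊕ D2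
  | Sum.inl a, Sum.inl b => Sum.inl (A1.l a b)
  | Sum.inr a, Sum.inr b => Sum.inr (A2.l a b)
  | x, _ => x

/-- Same-factor product `x ⊣ y` of letters (junk value on mixed factors). -/
def rmulL : D1 ⊕ D2 → D1 ⊕ D2 → D1 ⊕ D2
  | Sum.inl a, Sum.inl b => Sum.inl (A1.r a b)
  | Sum.inr a, Sum.inr b => Sum.inr (A2.r a b)
  | x, _ => x

/-- Push one letter onto a reduced word of the free product of groups `J₁ * J₂`
(the empty list representing the identity). -/
noncomputable def push (acc : List (D1 ⊕ D2)) (x : D1 ⊕ D2) : List (D1 ⊕ D2) :=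
  if unitL A1 A2 x then acc
  else
    match acc.getLast? with
    | none => [x]
    | some y =>
      if sameF y x then
        if unitL A1 A2 (lmulL A1 A2 y x) then acc.dropLast
        else acc.dropLast ++ [lmulL A1 A2 y x]
      else acc ++ [x]

/-- Reduction of a word of `J`-letters to the reduced word of `J₁ * J₂`. -/
noncomputable def reduceW (w : List (D1 ⊕ D2)) : List (D1 ⊕ D2) :=
  w.foldl (push A1 A2) []

/-- `ŵ`: the reduced word of `τ(w)` in `J₁ * J₂`. -/
noncomputable def hatW (w : List (D1 ⊕ D2)) : List (D1 ⊕ D2) :=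
  reduceW A1 A2 (w.map (tauL A1 A2))

/-- Convert the empty reduced word to its representative `e₁`. -/
noncomputable def toRep (w : List (D1 ⊕ D2)) : List (D1 ⊕ D2) :=
  if w = [] then [Sum.inl A1.one] else w

/-- A reduced word on `A₁ ∪ A₂°`: no units, and successive letters lie in
different factors. -/
def AltRed (u : List (D1 ⊕ D2)) : Prop :=
  (∀ c ∈ u, ¬ unitL A1 A2 c) ∧ List.Chain' (fun a b => ¬ sameF a b) u

/-- Membership in `Ω = Ω₁ ∪ Ω₂`. -/
def InOmega (z : List (D1 ⊕ D2) × ℕ) : Prop :=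
  (z.2 = 1 ∧ (z.1 = [Sum.inl A1.one] ∨
    (z.1 ≠ [] ∧ AltRed A1 A2 z.1 ∧ ∀ c ∈ z.1, inJ A1 A2 c))) ∨
  (∃ p x q, z.1 = p ++ x :: q ∧ z.2 = p.length + 1 ∧ ¬ inJ A1 A2 x ∧
    (∀ c ∈ p, inJ A1 A2 c) ∧ (∀ c ∈ q, inJ A1 A2 c) ∧ AltRed A1 A2 z.1)

/-- The carrier `Ω = Ω₁ ∪ Ω₂` of the free product of the digroups `A₁`, `A₂`. -/
def Omega : Type := {z : List (D1 ⊕ D2) × ℕ // InOmega A1 A2 z}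

/-- The operation `⊢` of `Ω`, on representatives. -/
noncomputable def opLspec (z z' : List (D1 ⊕ D2) × ℕ) : List (D1 ⊕ D2) × ℕ :=
  @ite _ (z'.2 = 1 ∧ ∀ c ∈ z'.1, inJ A1 A2 c) (Classical.propDecidable _)
    -- second operand is `[u]₁ ∈ Ω₁`:  `[w]_n ⊢ [u]₁ = [(wu)^]₁`
    ((toRep A1 (hatW A1 A2 (z.1 ++ z'.1)), 1))
    (
    -- second operand is `[pxq]_{|p|+1} ∈ Ω₂`
    let p := z'.1.take (z'.2 - 1)
    let x := z'.1.getD (z'.2 - 1) (Sum.inl A1.one)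
    let q := z'.1.drop z'.2
    let r := hatW A1 A2 (z.1 ++ p)
    match r.getLast? with
    | none => (x :: q, 1)  -- `(wp)^ = e₁`
    | some c =>
      if sameF c x then
        -- `(wp)^ = vc` with `c` in the same factor as `x`
        (r.dropLast ++ lmulL A1 A2 c x :: q, r.dropLast.length + 1)
      else (r ++ x :: q, r.length + 1))

/-- The operation `⊣` of `Ω`, on representatives. -/
noncomputable def opRspec (z z' : List (D1 ⊕ D2) × ℕ) : List (D1 ⊕ D2) × ℕ :=
  @ite _ (z.2 = 1 ∧ ∀ c ∈ z.1, inJ A1 A2 c) (Classical.propDecidable _)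
    -- first operand is `[u]₁ ∈ Ω₁`:  `[u]₁ ⊣ [w]_n = [(uw)^]₁`
    ((toRep A1 (hatW A1 A2 (z.1 ++ z'.1)), 1))
    (
    -- first operand is `[pxq]_{|p|+1} ∈ Ω₂`
    let p := z.1.take (z.2 - 1)
    let x := z.1.getD (z.2 - 1) (Sum.inl A1.one)
    let q := z.1.drop z.2
    let r := hatW A1 A2 (q ++ z'.1)
    match r with
    | [] => (p ++ [x], p.length + 1)  -- `(qw)^ = e₁`
    | c :: v =>
      if sameF x c then
        -- `(qw)^ = cv` with `c` in the same factor as `x`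
        (p ++ rmulL A1 A2 x c :: v, p.length + 1)
      else (p ++ x :: c :: v, p.length + 1))

end OmegaConstruction

namespace DigroupStruct

variable {D : Type} (A : DigroupStruct D)

lemma mem_groupPart_iff {a : D} : a ∈ groupPart A ↔ A.l a A.one = a := by
  constructor
  · rintro ⟨b, rfl⟩
    rw [A.l_assoc, A.one_l]
  · exact fun h => ⟨a, h.symm⟩

lemma l_one_mem (a : D) : A.l a A.one ∈ groupPart A := ⟨a, rfl⟩

lemma one_mem : A.one ∈ groupPart A := ⟨A.one, (A.one_l _).symm⟩

lemma inv_l_cancel (c x : D) : A.l (A.inv c) (A.l c x) = x := by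
  rw [← A.l_assoc, ← A.ax2, A.inv_r, A.one_l]

lemma r_inv_cancel (x c : D) : A.r (A.r x c) (A.inv c) = x := by
  rw [A.r_assoc, ← A.ax1, A.l_inv, A.r_one]

lemma one_r (c : D) : A.r A.one c = A.l c A.one := by
  calc A.r A.one c = A.l c (A.r (A.inv c) c) := by rw [A.ax3, A.l_inv]
    _ = A.l c A.one := by rw [A.inv_r]

lemma r_eq_of_mem {y : D} (hy : y ∈ groupPart A) (c : D) :
    A.r y c = A.l (A.l y c) A.one := by
  conv_lhs => rw [← A.mem_groupPart_iff.1 hy]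
  rw [← A.ax3, one_r, A.l_assoc]

lemma r_eq_l {y c : D} (hy : y ∈ groupPart A) (hc : c ∈ groupPart A) :
    A.r y c = A.l y c := by
  rw [A.r_eq_of_mem hy, A.l_assoc, A.mem_groupPart_iff.1 hc]

lemma l_mem_iff {c x : D} : A.l c x ∈ groupPart A ↔ x ∈ groupPart A := by
  simp only [mem_groupPart_iff, A.l_assoc]
  exact ⟨fun h => by simpa [inv_l_cancel] using congrArg (A.l (A.inv c)) h, fun h => by rw [h]⟩

lemma r_mem {y : D} (hy : y ∈ groupPart A) (c : D) : A.r y c ∈ groupPart A := by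
  rw [A.r_eq_of_mem hy]
  exact A.l_one_mem _

lemma r_mem_iff {x c : D} : A.r x c ∈ groupPart A ↔ x ∈ groupPart A :=
  ⟨fun h => A.r_inv_cancel x c ▸ A.r_mem h (A.inv c), fun h => A.r_mem h c⟩

lemma inv_mul_l_one (c : D) : A.l (A.l (A.inv c) c) A.one = A.one := by
  rw [A.l_assoc, inv_l_cancel]

end DigroupStruct

section Letters

variable {D1 D2 : Type} (A1 : DigroupStruct D1) (A2 : DigroupStruct D2)

/-- The inverse of a letter, computed in its factor. -/
def invL : D1 ⊕ D2 → D1 ⊕ D2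
  | Sum.inl a => Sum.inl (A1.inv a)
  | Sum.inr a => Sum.inr (A2.inv a)

variable {A1 A2}
variable {a b c x y : D1 ⊕ D2}

lemma sameF_lmulL_left (h : sameF c x) : sameF (lmulL A1 A2 c x) y ↔ sameF x y := by
  rcases c with c | c <;> rcases x with x | x <;> simp_all [sameF, lmulL]

lemma sameF_lmulL_right (h : sameF c x) : sameF y (lmulL A1 A2 c x) ↔ sameF y x := by
  rcases c with c | c <;> rcases x with x | x <;> simp_all [sameF, lmulL]

lemma sameF_rmulL_left : sameF (rmulL A1 A2 x c) y ↔ sameF x y := by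
  rcases c with c | c <;> rcases x with x | x <;> simp_all [sameF, rmulL]

lemma sameF_rmulL_right : sameF y (rmulL A1 A2 x c) ↔ sameF y x := by
  rcases c with c | c <;> rcases x with x | x <;> simp_all [sameF, rmulL]

lemma lmulL_assoc (h : sameF a b) (h' : sameF b c) :
    lmulL A1 A2 (lmulL A1 A2 a b) c = lmulL A1 A2 a (lmulL A1 A2 b c) := by
  rcases a with a | a <;> rcases b with b | b <;> rcases c with c | c <;>
    simp_all [sameF, lmulL, DisemigroupStruct.l_assoc]

lemma rmulL_assoc (h : sameF a b) (h' : sameF b c) (hb : inJ A1 A2 b) (hc : inJ A1 A2 c) :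
    rmulL A1 A2 (rmulL A1 A2 a b) c = rmulL A1 A2 a (lmulL A1 A2 b c) := by
  rcases a with a | a <;> rcases b with b | b <;> rcases c with c | c <;>
    simp_all [sameF, lmulL, rmulL, DisemigroupStruct.r_assoc, inJ, DigroupStruct.r_eq_l]

lemma lmulL_rmulL (h : sameF a b) (h' : sameF b c) :
    lmulL A1 A2 a (rmulL A1 A2 b c) = rmulL A1 A2 (lmulL A1 A2 a b) c := by
  rcases a with a | a <;> rcases b with b | b <;> rcases c with c | c <;>
    simp_all [sameF, lmulL, rmulL, DisemigroupStruct.ax3]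

lemma inJ_lmulL_iff (h : sameF c x) : inJ A1 A2 (lmulL A1 A2 c x) ↔ inJ A1 A2 x := by
  rcases c with c | c <;> rcases x with x | x <;>
    simp_all [sameF, lmulL, inJ, DigroupStruct.l_mem_iff]

lemma inJ_rmulL_iff : inJ A1 A2 (rmulL A1 A2 x c) ↔ inJ A1 A2 x := by
  rcases c with c | c <;> rcases x with x | x <;>
    simp_all [rmulL, inJ, DigroupStruct.r_mem_iff]

lemma inJ_of_unitL (h : unitL A1 A2 c) : inJ A1 A2 c := by
  rcases c with c | c <;> simp only [unitL] at h <;> subst h <;> exact DigroupStruct.one_mem _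

lemma unitL_lmulL (hs : sameF c x) (h : unitL A1 A2 c) : lmulL A1 A2 c x = x := by
  rcases c with c | c <;> rcases x with x | x <;>
    simp_all [sameF, lmulL, unitL, DigroupStruct.one_l]

lemma lmulL_unitL (hs : sameF x c) (hx : inJ A1 A2 x) (h : unitL A1 A2 c) :
    lmulL A1 A2 x c = x := by
  rcases c with c | c <;> rcases x with x | x <;>
    simp_all [sameF, lmulL, unitL, inJ, DigroupStruct.mem_groupPart_iff]

lemma rmulL_unitL (hs : sameF x c) (h : unitL A1 A2 c) : rmulL A1 A2 x c = x := by
  rcases c with c | c <;> rcases x with x | x <;>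
    simp_all [sameF, rmulL, unitL, DigroupStruct.r_one]

lemma tauL_eq_sharp (x : D1 ⊕ D2) : tauL A1 A2 x = sharp A1 A2 x := by
  unfold tauL
  split_ifs with h
  · rcases x with x | x <;> simp_all [sharp, inJ, DigroupStruct.mem_groupPart_iff]
  · rfl

lemma tauL_of_inJ (h : inJ A1 A2 x) : tauL A1 A2 x = x := if_pos h

lemma inJ_tauL (x : D1 ⊕ D2) : inJ A1 A2 (tauL A1 A2 x) := by
  rw [tauL_eq_sharp]
  rcases x with x | x <;> exact DigroupStruct.l_one_mem _ _

lemma sameF_tauL_right : sameF y (tauL A1 A2 x) ↔ sameF y x := by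
  rw [tauL_eq_sharp]
  rcases x with x | x <;> simp [sameF, sharp]

lemma sameF_tauL_left : sameF (tauL A1 A2 x) y ↔ sameF x y := by
  rw [tauL_eq_sharp]
  rcases x with x | x <;> simp [sameF, sharp]

lemma tauL_lmulL (h : sameF c x) :
    tauL A1 A2 (lmulL A1 A2 c x) = lmulL A1 A2 (tauL A1 A2 c) (tauL A1 A2 x) := by
  simp only [tauL_eq_sharp]
  rcases c with c | c <;> rcases x with x | x <;>
    simp_all [sameF, sharp, lmulL, DisemigroupStruct.l_assoc, DigroupStruct.one_l]

lemma tauL_rmulL (h : sameF x c) :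
    tauL A1 A2 (rmulL A1 A2 x c) = lmulL A1 A2 (tauL A1 A2 x) (tauL A1 A2 c) := by
  simp only [tauL_eq_sharp]
  rcases c with c | c <;> rcases x with x | x <;>
    simp_all [sameF, sharp, lmulL, rmulL, DisemigroupStruct.l_assoc, DisemigroupStruct.ax2,
      DigroupStruct.one_l]

lemma sameF_invL (c : D1 ⊕ D2) : sameF c (invL A1 A2 c) := by
  rcases c with c | c <;> rfl

lemma unitL_lmulL_invL (c : D1 ⊕ D2) :
    unitL A1 A2 (lmulL A1 A2 (tauL A1 A2 c) (tauL A1 A2 (invL A1 A2 c))) := by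
  rw [← tauL_lmulL (sameF_invL c), tauL_eq_sharp]
  rcases c with c | c <;>
    simp [invL, lmulL, sharp, unitL, DigroupStruct.l_inv, DigroupStruct.one_l]

lemma unitL_invL_lmulL (c : D1 ⊕ D2) :
    unitL A1 A2 (lmulL A1 A2 (tauL A1 A2 (invL A1 A2 c)) (tauL A1 A2 c)) := by
  rw [← tauL_lmulL (sameF_invL c).symm, tauL_eq_sharp]
  rcases c with c | c <;>
    simp [invL, lmulL, sharp, unitL, DigroupStruct.inv_mul_l_one]

end Letters

section Words

variable {D1 D2 : Type} (A1 : DigroupStruct D1) (A2 : DigroupStruct D2)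

/-- A reduced word of the free product of groups `J₁ * J₂`. -/
def Red (w : List (D1 ⊕ D2)) : Prop := AltRed A1 A2 w ∧ ∀ c ∈ w, inJ A1 A2 c

/-- Right action of arbitrary words on reduced words, through `τ`. -/
noncomputable def pushAll (acc w : List (D1 ⊕ D2)) : List (D1 ⊕ D2) :=
  (w.map (tauL A1 A2)).foldl (push A1 A2) acc

variable {A1 A2}
variable {c x y : D1 ⊕ D2} {p q r u v w acc : List (D1 ⊕ D2)}

lemma push_unit (h : unitL A1 A2 x) : push A1 A2 acc x = acc := if_pos h

lemma push_nil (h : ¬ unitL A1 A2 x) : push A1 A2 [] x = [x] := by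
  simp [push, h]

lemma push_concat_of_not_sameF (h : ¬ unitL A1 A2 x) (hs : ¬ sameF y x) :
    push A1 A2 (acc ++ [y]) x = acc ++ [y, x] := by
  simp [push, h, hs]

lemma push_concat_cancel (h : ¬ unitL A1 A2 x) (hs : sameF y x)
    (hu : unitL A1 A2 (lmulL A1 A2 y x)) : push A1 A2 (acc ++ [y]) x = acc := by
  simp [push, h, hs, hu]

lemma push_concat_mul (h : ¬ unitL A1 A2 x) (hs : sameF y x)
    (hu : ¬ unitL A1 A2 (lmulL A1 A2 y x)) :
    push A1 A2 (acc ++ [y]) x = acc ++ [lmulL A1 A2 y x] := by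
  simp [push, h, hs, hu]

lemma altRed_iff : AltRed A1 A2 u ↔
    (∀ c ∈ u, ¬ unitL A1 A2 c) ∧ u.IsChain (fun a b => ¬ sameF a b) := Iff.rfl

lemma altRed_append : AltRed A1 A2 (u ++ v) ↔ AltRed A1 A2 u ∧ AltRed A1 A2 v ∧
    ∀ a ∈ u.getLast?, ∀ b ∈ v.head?, ¬ sameF a b := by
  simp only [altRed_iff, List.mem_append, List.isChain_append]
  constructor
  · rintro ⟨h, h1, h2, h3⟩
    exact ⟨⟨fun c hc => h c (.inl hc), h1⟩, ⟨fun c hc => h c (.inr hc), h2⟩, h3⟩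
  · rintro ⟨⟨h, h1⟩, ⟨h', h2⟩, h3⟩
    exact ⟨fun c hc => hc.elim (h c) (h' c), h1, h2, h3⟩

lemma red_append : Red A1 A2 (u ++ v) ↔ Red A1 A2 u ∧ Red A1 A2 v ∧
    ∀ a ∈ u.getLast?, ∀ b ∈ v.head?, ¬ sameF a b := by
  simp only [Red, altRed_append, List.forall_mem_append]
  tauto

lemma altRed_singleton : AltRed A1 A2 [x] ↔ ¬ unitL A1 A2 x := by
  simp [altRed_iff]

lemma red_nil : Red A1 A2 [] := by simp [Red, altRed_iff]

lemma red_singleton : Red A1 A2 [x] ↔ ¬ unitL A1 A2 x ∧ inJ A1 A2 x := by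
  simp [Red, altRed_singleton]

lemma red_concat : Red A1 A2 (u ++ [x]) ↔
    Red A1 A2 u ∧ (¬ unitL A1 A2 x ∧ inJ A1 A2 x) ∧ ∀ a ∈ u.getLast?, ¬ sameF a x := by
  simp [red_append, red_singleton]

lemma red_cons : Red A1 A2 (x :: u) ↔
    (¬ unitL A1 A2 x ∧ inJ A1 A2 x) ∧ Red A1 A2 u ∧ ∀ a ∈ u.head?, ¬ sameF x a := by
  rw [← List.singleton_append, red_append, red_singleton]
  simp

lemma red_push (hr : Red A1 A2 acc) (hx : inJ A1 A2 x) : Red A1 A2 (push A1 A2 acc x) := by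
  by_cases hu : unitL A1 A2 x
  · rwa [push_unit hu]
  rcases List.eq_nil_or_concat' acc with rfl | ⟨r, y, rfl⟩
  · rw [push_nil hu]; exact red_singleton.2 ⟨hu, hx⟩
  rw [red_concat] at hr
  by_cases hs : sameF y x
  · by_cases hu' : unitL A1 A2 (lmulL A1 A2 y x)
    · rw [push_concat_cancel hu hs hu']; exact hr.1
    · rw [push_concat_mul hu hs hu', red_concat]
      refine ⟨hr.1, ⟨hu', (inJ_lmulL_iff hs).2 hx⟩, fun a ha => ?_⟩
      rw [sameF_lmulL_right hs]
      exact fun h => hr.2.2 a ha (h.trans hs.symm)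
  · rw [push_concat_of_not_sameF hu hs, ← List.singleton_append, ← List.append_assoc,
      red_concat, red_concat]
    exact ⟨hr, ⟨hu, hx⟩, by simpa using hs⟩

lemma push_push (hr : Red A1 A2 acc) (hy : inJ A1 A2 y) (hs : sameF y x) :
    push A1 A2 (push A1 A2 acc y) x = push A1 A2 acc (lmulL A1 A2 y x) := by
  by_cases hu : unitL A1 A2 y
  · rw [push_unit hu, unitL_lmulL hs hu]
  by_cases hux : unitL A1 A2 x
  · rw [push_unit hux, lmulL_unitL hs hy hux]
  rcases List.eq_nil_or_concat' acc with rfl | ⟨r, z, rfl⟩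
  · rw [push_nil hu, ← List.nil_append [y]]
    by_cases hu' : unitL A1 A2 (lmulL A1 A2 y x)
    · rw [push_concat_cancel hux hs hu', push_unit hu']
    · rw [push_concat_mul hux hs hu', push_nil hu', List.nil_append]
  rw [red_concat] at hr
  by_cases hz : sameF z y
  · have hassoc := lmulL_assoc (A1 := A1) (A2 := A2) hz hs
    have hzyx : sameF (lmulL A1 A2 z y) x := (sameF_lmulL_left hz).2 hs
    have hz_yx : sameF z (lmulL A1 A2 y x) := (sameF_lmulL_right hs).2 (hz.trans hs)
    by_cases hzy : unitL A1 A2 (lmulL A1 A2 z y)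
    · rw [push_concat_cancel hu hz hzy]
      have hzx : lmulL A1 A2 z (lmulL A1 A2 y x) = x := by
        rw [← hassoc, unitL_lmulL hzyx hzy]
      have hrx : push A1 A2 r x = r ++ [x] := by
        rcases List.eq_nil_or_concat' r with rfl | ⟨t, d, rfl⟩
        · exact push_nil hux
        · rw [push_concat_of_not_sameF hux, List.append_assoc]; · rfl
          exact fun h => hr.2.2 d (by simp) (h.trans (hz.trans hs).symm)
      rw [hrx]
      by_cases hyx : unitL A1 A2 (lmulL A1 A2 y x)
      · rw [push_unit hyx, ← hzx, lmulL_unitL hz_yx hr.2.1.2 hyx]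
      · rw [push_concat_mul hyx hz_yx (by rwa [hzx]), hzx]
    · rw [push_concat_mul hu hz hzy]
      by_cases hyx : unitL A1 A2 (lmulL A1 A2 y x)
      · have : lmulL A1 A2 (lmulL A1 A2 z y) x = z := by
          rw [hassoc, lmulL_unitL hz_yx hr.2.1.2 hyx]
        rw [push_unit hyx, push_concat_mul hux hzyx (by rw [this]; exact hr.2.1.1), this]
      · by_cases h3 : unitL A1 A2 (lmulL A1 A2 z (lmulL A1 A2 y x))
        · rw [push_concat_cancel hyx hz_yx h3, push_concat_cancel hux hzyx (by rwa [hassoc])]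
        · rw [push_concat_mul hyx hz_yx h3, push_concat_mul hux hzyx (by rwa [hassoc]), hassoc]
  · have hz' : ¬ sameF z (lmulL A1 A2 y x) := fun h =>
      hz (((sameF_lmulL_right hs).1 h).trans hs.symm)
    rw [push_concat_of_not_sameF hu hz, ← List.singleton_append, ← List.append_assoc]
    by_cases hu' : unitL A1 A2 (lmulL A1 A2 y x)
    · rw [push_concat_cancel hux hs hu', push_unit hu']
    · rw [push_concat_mul hux hs hu', push_concat_of_not_sameF hu' hz', List.append_assoc]
      rfl

lemma pushAll_append : pushAll A1 A2 acc (u ++ v) = pushAll A1 A2 (pushAll A1 A2 acc u) v := by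
  simp [pushAll]

lemma pushAll_singleton : pushAll A1 A2 acc [x] = push A1 A2 acc (tauL A1 A2 x) := rfl

lemma red_pushAll (hr : Red A1 A2 acc) : Red A1 A2 (pushAll A1 A2 acc w) := by
  induction w using List.reverseRecOn with
  | nil => exact hr
  | append_singleton w x ih =>
    rw [pushAll_append, pushAll_singleton]
    exact red_push ih (inJ_tauL x)

lemma red_hatW : Red A1 A2 (hatW A1 A2 w) := red_pushAll red_nil

lemma pushAll_push (ha : Red A1 A2 acc) (hr : Red A1 A2 r) (hx : inJ A1 A2 x) :
    pushAll A1 A2 acc (push A1 A2 r x) = push A1 A2 (pushAll A1 A2 acc r) x := by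
  by_cases hu : unitL A1 A2 x
  · rw [push_unit hu, push_unit hu]
  rcases List.eq_nil_or_concat' r with rfl | ⟨r, y, rfl⟩
  · rw [push_nil hu, pushAll_singleton, tauL_of_inJ hx]; rfl
  rw [red_concat] at hr
  by_cases hs : sameF y x
  · rw [pushAll_append, pushAll_singleton, tauL_of_inJ hr.2.1.2,
      push_push (red_pushAll ha) hr.2.1.2 hs]
    by_cases hu' : unitL A1 A2 (lmulL A1 A2 y x)
    · rw [push_concat_cancel hu hs hu', push_unit hu']
    · rw [push_concat_mul hu hs hu', pushAll_append, pushAll_singleton,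
        tauL_of_inJ ((inJ_lmulL_iff hs).2 hx)]
  · rw [push_concat_of_not_sameF hu hs, ← List.singleton_append, ← List.append_assoc,
      pushAll_append (v := [x]), pushAll_singleton, tauL_of_inJ hx]

lemma pushAll_hatW (ha : Red A1 A2 acc) :
    pushAll A1 A2 acc (hatW A1 A2 w) = pushAll A1 A2 acc w := by
  induction w using List.reverseRecOn with
  | nil => rfl
  | append_singleton w x ih =>
    have : hatW A1 A2 (w ++ [x]) = push A1 A2 (hatW A1 A2 w) (tauL A1 A2 x) := pushAll_append
    rw [this, pushAll_push ha red_hatW (inJ_tauL x), ih, pushAll_append, pushAll_singleton]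

lemma hatW_append : hatW A1 A2 (u ++ v) = pushAll A1 A2 (hatW A1 A2 u) v := pushAll_append

lemma hatW_concat : hatW A1 A2 (u ++ [x]) = push A1 A2 (hatW A1 A2 u) (tauL A1 A2 x) :=
  pushAll_append

lemma hatW_hatW : hatW A1 A2 (hatW A1 A2 w) = hatW A1 A2 w := pushAll_hatW red_nil

lemma hatW_append_congr {u' v' : List (D1 ⊕ D2)} (hu : hatW A1 A2 u = hatW A1 A2 u')
    (hv : hatW A1 A2 v = hatW A1 A2 v') : hatW A1 A2 (u ++ v) = hatW A1 A2 (u' ++ v') := by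
  rw [hatW_append, hatW_append, ← pushAll_hatW red_hatW, ← pushAll_hatW (w := v') red_hatW, hu, hv]

lemma hatW_append_hatW : hatW A1 A2 (u ++ hatW A1 A2 v) = hatW A1 A2 (u ++ v) :=
  hatW_append_congr rfl hatW_hatW

lemma hatW_hatW_append : hatW A1 A2 (hatW A1 A2 u ++ v) = hatW A1 A2 (u ++ v) :=
  hatW_append_congr hatW_hatW rfl

lemma hatW_toRep : hatW A1 A2 (toRep A1 w) = hatW A1 A2 w := by
  unfold toRep
  split_ifs with h
  · subst h
    have h1 : unitL A1 A2 (Sum.inl A1.one) := rfl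
    change push A1 A2 [] (tauL A1 A2 (Sum.inl A1.one)) = []
    rw [tauL_of_inJ (inJ_of_unitL h1), push_unit h1]
  · rfl

lemma pushAll_of_red (h : Red A1 A2 (acc ++ w)) : pushAll A1 A2 acc w = acc ++ w := by
  induction w using List.reverseRecOn with
  | nil => simp [pushAll]
  | append_singleton w x ih =>
    rw [← List.append_assoc, red_concat] at h
    rw [pushAll_append, ih h.1, pushAll_singleton, tauL_of_inJ h.2.1.2, ← List.append_assoc]
    rcases List.eq_nil_or_concat' (acc ++ w) with h0 | ⟨t, d, h0⟩
    · rw [h0, push_nil h.2.1.1]; rfl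
    · rw [h0] at h ⊢
      rw [push_concat_of_not_sameF h.2.1.1 (h.2.2 d (by simp)), List.append_assoc]; rfl

lemma hatW_of_red (h : Red A1 A2 w) : hatW A1 A2 w = w := pushAll_of_red (acc := []) h

lemma hatW_mul_invL (c : D1 ⊕ D2) : hatW A1 A2 [c, invL A1 A2 c] = [] := by
  change push A1 A2 (push A1 A2 [] _) _ = []
  rw [push_push red_nil (inJ_tauL _) (sameF_tauL_left.2 (sameF_tauL_right.2 (sameF_invL c))),
    push_unit (unitL_lmulL_invL c)]

lemma hatW_invL_mul (c : D1 ⊕ D2) : hatW A1 A2 [invL A1 A2 c, c] = [] := by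
  change push A1 A2 (push A1 A2 [] _) _ = []
  rw [push_push red_nil (inJ_tauL _)
    (sameF_tauL_left.2 (sameF_tauL_right.2 (sameF_invL c).symm)),
    push_unit (unitL_invL_lmulL c)]

lemma hatW_append_inv (w : List (D1 ⊕ D2)) :
    hatW A1 A2 (w ++ (w.map (invL A1 A2)).reverse) = [] := by
  induction w with
  | nil => rfl
  | cons c w ih =>
    have : (c :: w) ++ ((c :: w).map (invL A1 A2)).reverse =
      [c] ++ (w ++ (w.map (invL A1 A2)).reverse) ++ [invL A1 A2 c] := by simp
    rw [this, hatW_append_congr (hatW_append_congr rfl (ih.trans (hatW_of_red red_nil).symm)) rfl]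
    exact hatW_mul_invL c

lemma hatW_inv_append (w : List (D1 ⊕ D2)) :
    hatW A1 A2 ((w.map (invL A1 A2)).reverse ++ w) = [] := by
  induction w using List.reverseRecOn with
  | nil => rfl
  | append_singleton w c ih =>
    have : ((w ++ [c]).map (invL A1 A2)).reverse ++ (w ++ [c]) =
      [invL A1 A2 c] ++ ((w.map (invL A1 A2)).reverse ++ w) ++ [c] := by simp
    rw [this, hatW_append_congr (hatW_append_congr rfl (ih.trans (hatW_of_red red_nil).symm)) rfl]
    exact hatW_invL_mul c

lemma hatW_cons_of_sameF {c d : D1 ⊕ D2} (hr : Red A1 A2 (d :: r)) (hc : inJ A1 A2 c)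
    (hs : sameF c d) :
    hatW A1 A2 (c :: d :: r) =
      if unitL A1 A2 (lmulL A1 A2 c d) then r else lmulL A1 A2 c d :: r := by
  have hr' := red_cons.1 hr
  change pushAll A1 A2 (push A1 A2 (push A1 A2 [] _) _) r = _
  rw [tauL_of_inJ hc, tauL_of_inJ hr'.1.2, push_push red_nil hc hs]
  split_ifs with hu
  · rw [push_unit hu]; exact hatW_of_red hr'.2.1
  · rw [push_nil hu]
    refine pushAll_of_red (red_cons.2 ⟨⟨hu, (inJ_lmulL_iff hs).2 hr'.1.2⟩, hr'.2.1, fun a ha => ?_⟩)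
    rw [sameF_lmulL_left hs]
    exact hr'.2.2 a ha

lemma hatW_cons_unit (hr : Red A1 A2 r) (hc : unitL A1 A2 c) : hatW A1 A2 (c :: r) = r := by
  change pushAll A1 A2 (push A1 A2 [] _) r = _
  rw [tauL_of_inJ (inJ_of_unitL hc), push_unit hc]
  exact hatW_of_red hr

end Words

section Normalization

variable {D1 D2 : Type} (A1 : DigroupStruct D1) (A2 : DigroupStruct D2)

/-- `p` is a reduced word which can stand immediately before the letter `x`. -/
def RedBefore (p : List (D1 ⊕ D2)) (x : D1 ⊕ D2) : Prop :=
  Red A1 A2 p ∧ ∀ a ∈ p.getLast?, ¬ sameF a x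

/-- `q` is a reduced word which can stand immediately after the letter `x`. -/
def RedAfter (x : D1 ⊕ D2) (q : List (D1 ⊕ D2)) : Prop :=
  Red A1 A2 q ∧ ∀ a ∈ q.head?, ¬ sameF x a

/-- Absorb the last letter of `r` into `x` if both lie in the same factor. -/
noncomputable def absorbL (r : List (D1 ⊕ D2)) (x : D1 ⊕ D2) : List (D1 ⊕ D2) × (D1 ⊕ D2) :=
  match r.getLast? with
  | none => ([], x)
  | some c => if sameF c x then (r.dropLast, lmulL A1 A2 c x) else (r, x)

/-- Absorb the first letter of `r` into `x` if both lie in the same factor. -/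
noncomputable def absorbR (x : D1 ⊕ D2) (r : List (D1 ⊕ D2)) : (D1 ⊕ D2) × List (D1 ⊕ D2) :=
  match r with
  | [] => (x, [])
  | c :: v => if sameF x c then (rmulL A1 A2 x c, v) else (x, c :: v)

variable {A1 A2}
variable {c x y : D1 ⊕ D2} {p q r s u v w : List (D1 ⊕ D2)}

lemma absorbL_nil : absorbL A1 A2 [] x = ([], x) := rfl

lemma absorbL_concat_of_sameF (h : sameF c x) :
    absorbL A1 A2 (r ++ [c]) x = (r, lmulL A1 A2 c x) := by
  simp [absorbL, h]

lemma absorbL_concat_of_not_sameF (h : ¬ sameF c x) :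
    absorbL A1 A2 (r ++ [c]) x = (r ++ [c], x) := by
  simp [absorbL, h]

lemma absorbR_nil : absorbR A1 A2 x [] = (x, []) := rfl

lemma absorbR_cons_of_sameF (h : sameF x c) :
    absorbR A1 A2 x (c :: r) = (rmulL A1 A2 x c, r) := if_pos h

lemma absorbR_cons_of_not_sameF (h : ¬ sameF x c) :
    absorbR A1 A2 x (c :: r) = (x, c :: r) := if_neg h

lemma absorbL_of_redBefore (h : RedBefore A1 A2 p x) : absorbL A1 A2 p x = (p, x) := by
  rcases List.eq_nil_or_concat' p with rfl | ⟨t, d, rfl⟩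
  · rfl
  · exact absorbL_concat_of_not_sameF (h.2 d (by simp))

lemma absorbR_of_redAfter (h : RedAfter A1 A2 x q) : absorbR A1 A2 x q = (x, q) := by
  rcases q with _ | ⟨d, t⟩
  · rfl
  · exact absorbR_cons_of_not_sameF (h.2 d (by simp))

lemma sameF_absorbL : sameF (absorbL A1 A2 r x).2 y ↔ sameF x y := by
  rcases List.eq_nil_or_concat' r with rfl | ⟨t, d, rfl⟩
  · rfl
  by_cases h : sameF d x
  · rw [absorbL_concat_of_sameF h, sameF_lmulL_left h]
  · rw [absorbL_concat_of_not_sameF h]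

lemma sameF_absorbR : sameF y (absorbR A1 A2 x r).1 ↔ sameF y x := by
  rcases r with _ | ⟨d, t⟩
  · rfl
  by_cases h : sameF x d
  · rw [absorbR_cons_of_sameF h, sameF_rmulL_right]
  · rw [absorbR_cons_of_not_sameF h]

lemma inJ_absorbL : inJ A1 A2 (absorbL A1 A2 r x).2 ↔ inJ A1 A2 x := by
  rcases List.eq_nil_or_concat' r with rfl | ⟨t, d, rfl⟩
  · rfl
  by_cases h : sameF d x
  · rw [absorbL_concat_of_sameF h, inJ_lmulL_iff h]
  · rw [absorbL_concat_of_not_sameF h]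

lemma inJ_absorbR : inJ A1 A2 (absorbR A1 A2 x r).1 ↔ inJ A1 A2 x := by
  rcases r with _ | ⟨d, t⟩
  · rfl
  by_cases h : sameF x d
  · rw [absorbR_cons_of_sameF h, inJ_rmulL_iff]
  · rw [absorbR_cons_of_not_sameF h]

lemma redBefore_absorbL (hr : Red A1 A2 r) :
    RedBefore A1 A2 (absorbL A1 A2 r x).1 (absorbL A1 A2 r x).2 := by
  rcases List.eq_nil_or_concat' r with rfl | ⟨t, d, rfl⟩
  · exact ⟨red_nil, by simp [absorbL_nil]⟩
  by_cases h : sameF d x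
  · rw [absorbL_concat_of_sameF h]
    rw [red_concat] at hr
    refine ⟨hr.1, fun a ha => ?_⟩
    rw [sameF_lmulL_right h]
    exact fun h' => hr.2.2 a ha (h'.trans h.symm)
  · rw [absorbL_concat_of_not_sameF h]
    exact ⟨hr, by simpa using h⟩

lemma redAfter_absorbR (hr : Red A1 A2 r) :
    RedAfter A1 A2 (absorbR A1 A2 x r).1 (absorbR A1 A2 x r).2 := by
  rcases r with _ | ⟨d, t⟩
  · exact ⟨red_nil, by simp [absorbR_nil]⟩
  by_cases h : sameF x d
  · rw [absorbR_cons_of_sameF h]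
    rw [red_cons] at hr
    refine ⟨hr.2.1, fun a ha => ?_⟩
    rw [sameF_rmulL_left]
    exact fun h' => hr.2.2 a ha (h.symm.trans h')
  · rw [absorbR_cons_of_not_sameF h]
    exact ⟨hr, by simpa using h⟩

lemma RedBefore.congr (h : RedBefore A1 A2 p x) (hxy : ∀ a, sameF a y ↔ sameF a x) :
    RedBefore A1 A2 p y :=
  ⟨h.1, fun a ha => by rw [hxy]; exact h.2 a ha⟩

lemma RedAfter.congr (h : RedAfter A1 A2 x q) (hxy : ∀ a, sameF y a ↔ sameF x a) :
    RedAfter A1 A2 y q :=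
  ⟨h.1, fun a ha => by rw [hxy]; exact h.2 a ha⟩

lemma absorbL_push (hr : Red A1 A2 r) (h : sameF c x) :
    absorbL A1 A2 (push A1 A2 r c) x = absorbL A1 A2 r (lmulL A1 A2 c x) := by
  by_cases hu : unitL A1 A2 c
  · rw [push_unit hu, unitL_lmulL h hu]
  rcases List.eq_nil_or_concat' r with rfl | ⟨t, d, rfl⟩
  · rw [push_nil hu, ← List.nil_append [c], absorbL_concat_of_sameF h, absorbL_nil]
  rw [red_concat] at hr
  by_cases hs : sameF d c
  · rw [absorbL_concat_of_sameF ((sameF_lmulL_right h).2 (hs.trans h)), ← lmulL_assoc hs h]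
    have hs' : sameF (lmulL A1 A2 d c) x := (sameF_lmulL_left hs).2 h
    by_cases hu' : unitL A1 A2 (lmulL A1 A2 d c)
    · rw [push_concat_cancel hu hs hu', unitL_lmulL hs' hu']
      exact absorbL_of_redBefore ⟨hr.1, fun a ha h' =>
        hr.2.2 a ha (h'.trans (hs.trans h).symm)⟩
    · rw [push_concat_mul hu hs hu', absorbL_concat_of_sameF hs']
  · rw [push_concat_of_not_sameF hu hs, absorbL_concat_of_not_sameF, ← List.singleton_append,
      ← List.append_assoc, absorbL_concat_of_sameF h]
    rw [sameF_lmulL_right h]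
    exact fun h' => hs (h'.trans h.symm)

lemma absorbR_hatW_cons (hr : Red A1 A2 r) (hc : inJ A1 A2 c) (h : sameF x c) :
    absorbR A1 A2 x (hatW A1 A2 (c :: r)) = absorbR A1 A2 (rmulL A1 A2 x c) r := by
  by_cases hu : unitL A1 A2 c
  · rw [hatW_cons_unit hr hu, rmulL_unitL h hu]
  rcases r with _ | ⟨d, t⟩
  · rw [hatW_of_red (red_singleton.2 ⟨hu, hc⟩), absorbR_cons_of_sameF h, absorbR_nil]
  have hr' := red_cons.1 hr
  by_cases hs : sameF c d
  · rw [hatW_cons_of_sameF hr hc hs, absorbR_cons_of_sameF (sameF_rmulL_left.2 (h.trans hs)),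
      rmulL_assoc h hs hc hr'.1.2]
    have hs' : sameF x (lmulL A1 A2 c d) := (sameF_lmulL_right hs).2 (h.trans hs)
    split_ifs with hu'
    · rw [rmulL_unitL hs' hu']
      exact absorbR_of_redAfter ⟨hr'.2.1, fun a ha h' =>
        hr'.2.2 a ha ((h.trans hs).symm.trans h')⟩
    · rw [absorbR_cons_of_sameF hs']
  · rw [hatW_of_red (red_cons.2 ⟨⟨hu, hc⟩, hr, by simpa using hs⟩), absorbR_cons_of_sameF h,
      absorbR_cons_of_not_sameF]
    rw [sameF_rmulL_left]
    exact fun h' => hs (h.symm.trans h')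

lemma absorbL_hatW_append (hr : Red A1 A2 r) :
    absorbL A1 A2 (hatW A1 A2 (v ++ r)) x =
      absorbL A1 A2 (hatW A1 A2 (v ++ (absorbL A1 A2 r x).1)) (absorbL A1 A2 r x).2 := by
  rcases List.eq_nil_or_concat' r with rfl | ⟨t, d, rfl⟩
  · rfl
  by_cases h : sameF d x
  · rw [absorbL_concat_of_sameF h, ← List.append_assoc, hatW_concat,
      tauL_of_inJ (red_concat.1 hr).2.1.2, absorbL_push red_hatW h]
  · rw [absorbL_concat_of_not_sameF h]

lemma absorbR_hatW_append (hr : Red A1 A2 r) :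
    absorbR A1 A2 x (hatW A1 A2 (r ++ v)) =
      absorbR A1 A2 (absorbR A1 A2 x r).1 (hatW A1 A2 ((absorbR A1 A2 x r).2 ++ v)) := by
  rcases r with _ | ⟨d, t⟩
  · rfl
  by_cases h : sameF x d
  · rw [absorbR_cons_of_sameF h, ← absorbR_hatW_cons red_hatW (red_cons.1 hr).1.2 h]
    exact congrArg _ (hatW_append_hatW (u := [d])).symm
  · rw [absorbR_cons_of_not_sameF h]

lemma absorbL_rmulL (h : sameF x c) :
    absorbL A1 A2 r (rmulL A1 A2 x c) =
      ((absorbL A1 A2 r x).1, rmulL A1 A2 (absorbL A1 A2 r x).2 c) := by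
  rcases List.eq_nil_or_concat' r with rfl | ⟨t, d, rfl⟩
  · rfl
  by_cases hd : sameF d x
  · rw [absorbL_concat_of_sameF hd, absorbL_concat_of_sameF (sameF_rmulL_right.2 hd),
      lmulL_rmulL hd h]
  · rw [absorbL_concat_of_not_sameF hd,
      absorbL_concat_of_not_sameF (mt sameF_rmulL_right.1 hd)]

lemma absorb_comm :
    absorbL A1 A2 r (absorbR A1 A2 x s).1 =
      ((absorbL A1 A2 r x).1, (absorbR A1 A2 (absorbL A1 A2 r x).2 s).1) ∧
    (absorbR A1 A2 (absorbL A1 A2 r x).2 s).2 = (absorbR A1 A2 x s).2 := by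
  rcases s with _ | ⟨d, t⟩
  · exact ⟨rfl, rfl⟩
  by_cases h : sameF x d
  · rw [absorbR_cons_of_sameF h, absorbR_cons_of_sameF (sameF_absorbL.2 h)]
    exact ⟨absorbL_rmulL h, rfl⟩
  · rw [absorbR_cons_of_not_sameF h, absorbR_cons_of_not_sameF (mt sameF_absorbL.1 h)]
    exact ⟨rfl, rfl⟩

lemma hatW_lmulL (h : sameF c x) : hatW A1 A2 [lmulL A1 A2 c x] = hatW A1 A2 [c, x] := by
  change push A1 A2 [] _ = push A1 A2 (push A1 A2 [] _) _
  rw [push_push red_nil (inJ_tauL _) (sameF_tauL_left.2 (sameF_tauL_right.2 h)), tauL_lmulL h]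

lemma hatW_rmulL (h : sameF x c) : hatW A1 A2 [rmulL A1 A2 x c] = hatW A1 A2 [x, c] := by
  change push A1 A2 [] _ = push A1 A2 (push A1 A2 [] _) _
  rw [push_push red_nil (inJ_tauL _) (sameF_tauL_left.2 (sameF_tauL_right.2 h)), tauL_rmulL h]

lemma hatW_absorbL :
    hatW A1 A2 ((absorbL A1 A2 r x).1 ++ [(absorbL A1 A2 r x).2]) = hatW A1 A2 (r ++ [x]) := by
  rcases List.eq_nil_or_concat' r with rfl | ⟨t, d, rfl⟩
  · rfl
  by_cases h : sameF d x
  · rw [absorbL_concat_of_sameF h, hatW_append_congr rfl (hatW_lmulL h), List.append_assoc]; rfl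
  · rw [absorbL_concat_of_not_sameF h]

lemma hatW_absorbR :
    hatW A1 A2 ((absorbR A1 A2 x r).1 :: (absorbR A1 A2 x r).2) = hatW A1 A2 (x :: r) := by
  rcases r with _ | ⟨d, t⟩
  · rfl
  by_cases h : sameF x d
  · rw [absorbR_cons_of_sameF h, ← List.singleton_append,
      hatW_append_congr (hatW_rmulL h) rfl]; rfl
  · rw [absorbR_cons_of_not_sameF h]

end Normalization

section OmegaDigroup

variable {D1 D2 : Type} {A1 : DigroupStruct D1} {A2 : DigroupStruct D2}
variable {x y : D1 ⊕ D2} {p q r u v w : List (D1 ⊕ D2)} {z z' : List (D1 ⊕ D2) × ℕ}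

lemma altRed_mid_iff (hp : ∀ c ∈ p, inJ A1 A2 c) (hq : ∀ c ∈ q, inJ A1 A2 c) :
    AltRed A1 A2 (p ++ x :: q) ↔
      RedBefore A1 A2 p x ∧ ¬ unitL A1 A2 x ∧ RedAfter A1 A2 x q := by
  rw [← List.singleton_append, altRed_append, altRed_append, altRed_singleton]
  simp only [RedBefore, RedAfter, Red, List.getLast?_singleton, List.head?_cons,
    Option.mem_some, forall_eq', List.singleton_append]
  tauto

lemma inOmega_toRep (hw : Red A1 A2 w) : InOmega A1 A2 (toRep A1 w, 1) := by
  unfold toRep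
  split_ifs with h
  · exact .inl ⟨rfl, .inl rfl⟩
  · exact .inl ⟨rfl, .inr ⟨h, hw⟩⟩

lemma inOmega_mid (hx : ¬ inJ A1 A2 x) (hp : RedBefore A1 A2 p x) (hq : RedAfter A1 A2 x q) :
    InOmega A1 A2 (p ++ x :: q, p.length + 1) :=
  .inr ⟨p, x, q, rfl, rfl, hx, hp.1.2, hq.1.2,
    (altRed_mid_iff hp.1.2 hq.1.2).2 ⟨hp, fun h => hx (inJ_of_unitL h), hq⟩⟩

lemma InOmega.cases (h : InOmega A1 A2 z) :
    (∃ w, Red A1 A2 w ∧ z = (toRep A1 w, 1)) ∨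
    ∃ p x q, ¬ inJ A1 A2 x ∧ RedBefore A1 A2 p x ∧ RedAfter A1 A2 x q ∧
      z = (p ++ x :: q, p.length + 1) := by
  rcases h with ⟨h2, h1 | ⟨h1, h⟩⟩ | ⟨p, x, q, h1, h2, hx, hp, hq, h⟩
  · exact .inl ⟨[], red_nil, Prod.ext h1 h2⟩
  · exact .inl ⟨z.1, h, Prod.ext (if_neg h1).symm h2⟩
  · rw [h1, altRed_mid_iff hp hq] at h
    exact .inr ⟨p, x, q, hx, h.1, h.2.2, Prod.ext h1 h2⟩

lemma inJ_of_mem_toRep (hw : Red A1 A2 w) : ∀ c ∈ toRep A1 w, inJ A1 A2 c := by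
  unfold toRep
  split_ifs with h
  · simpa using inJ_of_unitL (A1 := A1) (A2 := A2) (c := Sum.inl A1.one) rfl
  · exact hw.2

lemma opLspec_word (hw : Red A1 A2 w) :
    opLspec A1 A2 z (toRep A1 w, 1) = (toRep A1 (hatW A1 A2 (z.1 ++ w)), 1) := by
  unfold opLspec
  rw [if_pos ⟨rfl, inJ_of_mem_toRep hw⟩, hatW_append_congr rfl hatW_toRep]

lemma opRspec_word (hw : Red A1 A2 w) :
    opRspec A1 A2 (toRep A1 w, 1) z = (toRep A1 (hatW A1 A2 (w ++ z.1)), 1) := by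
  unfold opRspec
  rw [if_pos ⟨rfl, inJ_of_mem_toRep hw⟩, hatW_append_congr hatW_toRep rfl]

lemma opLspec_mid (hx : ¬ inJ A1 A2 x) :
    opLspec A1 A2 z (p ++ x :: q, p.length + 1) =
      ((absorbL A1 A2 (hatW A1 A2 (z.1 ++ p)) x).1 ++
        (absorbL A1 A2 (hatW A1 A2 (z.1 ++ p)) x).2 :: q,
        (absorbL A1 A2 (hatW A1 A2 (z.1 ++ p)) x).1.length + 1) := by
  unfold opLspec
  rw [if_neg (fun h => hx (h.2 x (by simp)))]
  have hd : (p ++ x :: q).drop (p.length + 1) = q := by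
    rw [← List.drop_drop]; simp
  simp only [Nat.add_sub_cancel, List.take_left', hd, List.getD_append_right _ _ _ _ le_rfl,
    Nat.sub_self, List.getD_cons_zero]
  rcases List.eq_nil_or_concat' (hatW A1 A2 (z.1 ++ p)) with h | ⟨t, d, h⟩
  · simp [h, absorbL_nil]
  · rw [h]
    by_cases hs : sameF d x
    · simp [absorbL_concat_of_sameF hs, hs]
    · simp [absorbL_concat_of_not_sameF hs, hs]

lemma opRspec_mid (hx : ¬ inJ A1 A2 x) :
    opRspec A1 A2 (p ++ x :: q, p.length + 1) z =
      (p ++ (absorbR A1 A2 x (hatW A1 A2 (q ++ z.1))).1 ::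
        (absorbR A1 A2 x (hatW A1 A2 (q ++ z.1))).2, p.length + 1) := by
  unfold opRspec
  rw [if_neg (fun h => hx (h.2 x (by simp)))]
  have hd : (p ++ x :: q).drop (p.length + 1) = q := by
    rw [← List.drop_drop]; simp
  simp only [Nat.add_sub_cancel, List.take_left', hd, List.getD_append_right _ _ _ _ le_rfl,
    Nat.sub_self, List.getD_cons_zero]
  rcases hatW A1 A2 (q ++ z.1) with _ | ⟨d, t⟩
  · simp [absorbR_nil]
  · by_cases hs : sameF x d
    · simp [absorbR_cons_of_sameF hs, hs]
    · simp [absorbR_cons_of_not_sameF hs, hs]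

lemma inOmega_opLspec (h' : InOmega A1 A2 z') : InOmega A1 A2 (opLspec A1 A2 z z') := by
  rcases h'.cases with ⟨w, hw, rfl⟩ | ⟨p, x, q, hx, hp, hq, rfl⟩
  · rw [opLspec_word hw]
    exact inOmega_toRep red_hatW
  · rw [opLspec_mid hx]
    exact inOmega_mid (mt inJ_absorbL.1 hx) (redBefore_absorbL red_hatW)
      (hq.congr fun a => sameF_absorbL)

lemma inOmega_opRspec (h : InOmega A1 A2 z) : InOmega A1 A2 (opRspec A1 A2 z z') := by
  rcases h.cases with ⟨w, hw, rfl⟩ | ⟨p, x, q, hx, hp, hq, rfl⟩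
  · rw [opRspec_word hw]
    exact inOmega_toRep red_hatW
  · rw [opRspec_mid hx]
    exact inOmega_mid (mt inJ_absorbR.1 hx) (hp.congr fun a => sameF_absorbR)
      (redAfter_absorbR red_hatW)

lemma hatW_opLspec (h' : InOmega A1 A2 z') :
    hatW A1 A2 (opLspec A1 A2 z z').1 = hatW A1 A2 (z.1 ++ z'.1) := by
  rcases h'.cases with ⟨w, hw, rfl⟩ | ⟨p, x, q, hx, hp, hq, rfl⟩
  · rw [opLspec_word hw, hatW_toRep, hatW_hatW, hatW_append_congr rfl hatW_toRep]
  · rw [opLspec_mid hx]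
    simp only
    rw [List.append_cons, hatW_append_congr hatW_absorbL rfl,
      hatW_append_congr (hatW_append_congr hatW_hatW rfl) rfl]
    simp

lemma hatW_opRspec (h : InOmega A1 A2 z) :
    hatW A1 A2 (opRspec A1 A2 z z').1 = hatW A1 A2 (z.1 ++ z'.1) := by
  rcases h.cases with ⟨w, hw, rfl⟩ | ⟨p, x, q, hx, hp, hq, rfl⟩
  · rw [opRspec_word hw, hatW_toRep, hatW_hatW, hatW_append_congr hatW_toRep rfl]
  · rw [opRspec_mid hx]
    simp only
    rw [hatW_append_congr rfl hatW_absorbR, ← List.singleton_append,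
      hatW_append_congr rfl (hatW_append_congr rfl hatW_hatW)]
    simp

lemma opLspec_congr {z₁ z₂ : List (D1 ⊕ D2) × ℕ} (h : hatW A1 A2 z₁.1 = hatW A1 A2 z₂.1)
    (h' : InOmega A1 A2 z') : opLspec A1 A2 z₁ z' = opLspec A1 A2 z₂ z' := by
  rcases h'.cases with ⟨w, hw, rfl⟩ | ⟨p, x, q, hx, hp, hq, rfl⟩
  · rw [opLspec_word hw, opLspec_word hw, hatW_append_congr h rfl]
  · rw [opLspec_mid hx, opLspec_mid hx, hatW_append_congr h rfl]

lemma opRspec_congr {z₁ z₂ : List (D1 ⊕ D2) × ℕ} (h : hatW A1 A2 z₁.1 = hatW A1 A2 z₂.1)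
    (h' : InOmega A1 A2 z') : opRspec A1 A2 z' z₁ = opRspec A1 A2 z' z₂ := by
  rcases h'.cases with ⟨w, hw, rfl⟩ | ⟨p, x, q, hx, hp, hq, rfl⟩
  · rw [opRspec_word hw, opRspec_word hw, hatW_append_congr rfl h]
  · rw [opRspec_mid hx, opRspec_mid hx, hatW_append_congr rfl h]

lemma opLspec_nil (h' : InOmega A1 A2 z') (n : ℕ) : opLspec A1 A2 ([], n) z' = z' := by
  rcases h'.cases with ⟨w, hw, rfl⟩ | ⟨p, x, q, hx, hp, hq, rfl⟩
  · rw [opLspec_word hw, List.nil_append, hatW_of_red hw]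
  · rw [opLspec_mid hx, List.nil_append, hatW_of_red hp.1, absorbL_of_redBefore hp]

lemma opRspec_nil (h' : InOmega A1 A2 z') (n : ℕ) : opRspec A1 A2 z' ([], n) = z' := by
  rcases h'.cases with ⟨w, hw, rfl⟩ | ⟨p, x, q, hx, hp, hq, rfl⟩
  · rw [opRspec_word hw, List.append_nil, hatW_of_red hw]
  · rw [opRspec_mid hx, List.append_nil, hatW_of_red hq.1, absorbR_of_redAfter hq]

lemma opLspec_append (h' : InOmega A1 A2 z') (m n k : ℕ) :
    opLspec A1 A2 (u ++ v, m) z' = opLspec A1 A2 (u, n) (opLspec A1 A2 (v, k) z') := by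
  rcases h'.cases with ⟨w, hw, rfl⟩ | ⟨p, x, q, hx, hp, hq, rfl⟩
  · rw [opLspec_word hw, opLspec_word hw, opLspec_word red_hatW, hatW_append_hatW,
      List.append_assoc]
  · rw [opLspec_mid hx, opLspec_mid hx, opLspec_mid (mt inJ_absorbL.1 hx),
      ← absorbL_hatW_append red_hatW, hatW_append_hatW, List.append_assoc]

lemma opRspec_append (h' : InOmega A1 A2 z') (m n k : ℕ) :
    opRspec A1 A2 z' (u ++ v, m) = opRspec A1 A2 (opRspec A1 A2 z' (u, n)) (v, k) := by
  rcases h'.cases with ⟨w, hw, rfl⟩ | ⟨p, x, q, hx, hp, hq, rfl⟩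
  · rw [opRspec_word hw, opRspec_word hw, opRspec_word red_hatW, hatW_hatW_append,
      List.append_assoc]
  · rw [opRspec_mid hx, opRspec_mid hx, opRspec_mid (mt inJ_absorbR.1 hx),
      ← absorbR_hatW_append red_hatW, hatW_hatW_append, List.append_assoc]

lemma opLspec_opRspec_comm {a b c : List (D1 ⊕ D2) × ℕ} (hb : InOmega A1 A2 b) :
    opLspec A1 A2 a (opRspec A1 A2 b c) = opRspec A1 A2 (opLspec A1 A2 a b) c := by
  rcases hb.cases with ⟨w, hw, rfl⟩ | ⟨p, x, q, hx, hp, hq, rfl⟩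
  · rw [opRspec_word hw, opLspec_word hw, opLspec_word red_hatW, opRspec_word red_hatW,
      hatW_append_hatW, hatW_hatW_append, List.append_assoc]
  · rw [opRspec_mid hx, opLspec_mid hx, opLspec_mid (mt inJ_absorbR.1 hx),
      opRspec_mid (mt inJ_absorbL.1 hx), absorb_comm.1, absorb_comm.2]

variable (A1 A2)

/-- The digroup structure on `Ω`. -/
noncomputable def omegaDigroup : DigroupStruct (Omega A1 A2) where
  l a b := ⟨opLspec A1 A2 a.1 b.1, inOmega_opLspec b.2⟩
  r a b := ⟨opRspec A1 A2 a.1 b.1, inOmega_opRspec a.2⟩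
  one := ⟨(toRep A1 [], 1), inOmega_toRep red_nil⟩
  inv a := ⟨(toRep A1 (hatW A1 A2 (a.1.1.map (invL A1 A2)).reverse), 1), inOmega_toRep red_hatW⟩
  l_assoc a b c := Subtype.ext <|
    (opLspec_congr (z₂ := (a.1.1 ++ b.1.1, 0)) (hatW_opLspec b.2) c.2).trans
      (opLspec_append c.2 0 a.1.2 b.1.2)
  r_assoc a b c := Subtype.ext <|
    ((opRspec_congr (z₂ := (b.1.1 ++ c.1.1, 0)) (hatW_opRspec b.2) a.2).trans
      (opRspec_append a.2 0 b.1.2 c.1.2)).symm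
  ax1 a b c := Subtype.ext <|
    opRspec_congr ((hatW_opLspec c.2).trans (hatW_opRspec b.2).symm) a.2
  ax2 a b c := Subtype.ext <|
    opLspec_congr ((hatW_opRspec a.2).trans (hatW_opLspec b.2).symm) c.2
  ax3 a b c := Subtype.ext (opLspec_opRspec_comm b.2)
  one_l a := Subtype.ext <|
    (opLspec_congr (z₂ := ([], 0)) (hatW_toRep (A1 := A1) (A2 := A2) (w := [])) a.2).trans
      (opLspec_nil a.2 0)
  r_one a := Subtype.ext <|
    (opRspec_congr (z₂ := ([], 0)) (hatW_toRep (A1 := A1) (A2 := A2) (w := [])) a.2).trans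
      (opRspec_nil a.2 0)
  l_inv a := Subtype.ext <| (opLspec_word red_hatW).trans <| by
    rw [hatW_append_hatW, hatW_append_inv]
  inv_r a := Subtype.ext <| (opRspec_word red_hatW).trans <| by
    rw [hatW_hatW_append, hatW_inv_append]

end OmegaDigroup

section Fold

variable {L C : Type} (G : DigroupStruct C) (F : L → C)

/-- The iterated left product `F c₁ ⊢ (F c₂ ⊢ (⋯ ⊢ y))`. -/
def lfold (w : List L) (y : C) : C := w.foldr (fun c y => G.l (F c) y) y

/-- The iterated right product `((y ⊣ F c₁) ⊣ F c₂) ⊣ ⋯`. -/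
def rfold (y : C) (w : List L) : C := w.foldl (fun y c => G.r y (F c)) y

variable {G F}
variable {u v w : List L} {y z : C} {c : L}

lemma lfold_append : lfold G F (u ++ v) y = lfold G F u (lfold G F v y) := List.foldr_append

lemma rfold_append : rfold G F y (u ++ v) = rfold G F (rfold G F y u) v := List.foldl_append

lemma lfold_r : lfold G F w (G.r y z) = G.r (lfold G F w y) z := by
  induction w with
  | nil => rfl
  | cons c w ih =>
    change G.l (F c) (lfold G F w (G.r y z)) = G.r (G.l (F c) (lfold G F w y)) z
    rw [ih, G.ax3]

lemma lfold_rfold : lfold G F w (rfold G F y v) = rfold G F (lfold G F w y) v := by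
  induction v generalizing y with
  | nil => rfl
  | cons c v ih =>
    change lfold G F w (rfold G F (G.r y (F c)) v) = rfold G F (G.r (lfold G F w y) (F c)) v
    rw [ih, lfold_r]

lemma lfold_l : G.l (lfold G F w y) z = lfold G F w (G.l y z) := by
  induction w with
  | nil => rfl
  | cons c w ih =>
    change G.l (G.l (F c) (lfold G F w y)) z = G.l (F c) (lfold G F w (G.l y z))
    rw [G.l_assoc, ih]

lemma r_rfold : G.r z (rfold G F y w) = rfold G F (G.r z y) w := by
  induction w generalizing y with
  | nil => rfl
  | cons c w ih =>
    change G.r z (rfold G F (G.r y (F c)) w) = rfold G F (G.r (G.r z y) (F c)) w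
    rw [ih, G.r_assoc]

lemma rfold_l : G.l (rfold G F y w) z = G.l y (lfold G F w z) := by
  induction w generalizing y with
  | nil => rfl
  | cons c w ih =>
    change G.l (rfold G F (G.r y (F c)) w) z = G.l y (G.l (F c) (lfold G F w z))
    rw [ih, G.ax2, G.l_assoc]

lemma r_lfold : G.r z (lfold G F w y) = G.r (rfold G F z w) y := by
  induction w generalizing z with
  | nil => rfl
  | cons c w ih =>
    change G.r z (G.l (F c) (lfold G F w y)) = G.r (rfold G F (G.r z (F c)) w) y
    rw [G.ax1, ← G.r_assoc, ih]

lemma lfold_one : lfold G F w G.one = rfold G F G.one w := by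
  induction w with
  | nil => rfl
  | cons c w ih =>
    change G.l (F c) (lfold G F w G.one) = rfold G F (G.r G.one (F c)) w
    rw [ih, G.one_r]
    exact lfold_rfold (w := [c])

variable {C' : Type} {G' : DigroupStruct C'} {ψ : C → C'}

lemma IsDigroupHom.map_lfold (h : IsDigroupHom G G' ψ) :
    ψ (lfold G F w y) = lfold G' (ψ ∘ F) w (ψ y) := by
  induction w with
  | nil => rfl
  | cons c w ih => exact (h.1 _ _).trans (congrArg _ ih)

lemma IsDigroupHom.map_rfold (h : IsDigroupHom G G' ψ) :
    ψ (rfold G F y w) = rfold G' (ψ ∘ F) (ψ y) w := by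
  induction w generalizing y with
  | nil => rfl
  | cons c w ih =>
    change ψ (rfold G F (G.r y (F c)) w) = rfold G' (ψ ∘ F) (G'.r (ψ y) (ψ (F c))) w
    rw [ih, h.2.1]

end Fold

section Extension

variable {D1 D2 C : Type} (A1 : DigroupStruct D1) (A2 : DigroupStruct D2) (G : DigroupStruct C)

/-- A map on letters induced by digroup homomorphisms on the two factors. -/
structure IsLetterHom (F : D1 ⊕ D2 → C) : Prop where
  map_lmulL : ∀ c x, sameF c x → F (lmulL A1 A2 c x) = G.l (F c) (F x)
  map_rmulL : ∀ x c, sameF x c → F (rmulL A1 A2 x c) = G.r (F x) (F c)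
  map_unit : ∀ c, unitL A1 A2 c → F c = G.one

variable {A1 A2 G}

lemma isLetterHom_elim {f1 : D1 → C} {f2 : D2 → C} (h1 : IsDigroupHom A1 G f1)
    (h2 : IsDigroupHom A2 G f2) : IsLetterHom A1 A2 G (Sum.elim f1 f2) where
  map_lmulL c x h := by
    rcases c with c | c <;> rcases x with x | x <;>
      simp_all [sameF, lmulL, h1.1, h2.1]
  map_rmulL c x h := by
    rcases c with c | c <;> rcases x with x | x <;>
      simp_all [sameF, rmulL, h1.2.1, h2.2.1]
  map_unit c h := by
    rcases c with c | c <;> simp_all [unitL, h1.2.2, h2.2.2]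

variable (A1 G) in
/-- The value in `G` of a word with a distinguished letter. -/
def wordValue (F : D1 ⊕ D2 → C) (z : List (D1 ⊕ D2) × ℕ) : C :=
  rfold G F (lfold G F (z.1.take (z.2 - 1)) (F (z.1.getD (z.2 - 1) (Sum.inl A1.one))))
    (z.1.drop z.2)

lemma wordValue_mid {F : D1 ⊕ D2 → C} {p q : List (D1 ⊕ D2)} {x : D1 ⊕ D2} :
    wordValue A1 G F (p ++ x :: q, p.length + 1) = rfold G F (lfold G F p (F x)) q := by
  have hd : (p ++ x :: q).drop (p.length + 1) = q := by
    rw [← List.drop_drop]; simp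
  simp only [wordValue, Nat.add_sub_cancel, List.take_left', hd,
    List.getD_append_right _ _ _ _ le_rfl, Nat.sub_self, List.getD_cons_zero]

namespace IsLetterHom

variable {F : D1 ⊕ D2 → C} (hF : IsLetterHom A1 A2 G F)
variable {x c : D1 ⊕ D2} {p q r w : List (D1 ⊕ D2)} {y : C} {z z' : List (D1 ⊕ D2) × ℕ}

include hF

lemma map_tauL : F (tauL A1 A2 c) = G.l (F c) G.one := by
  rw [tauL_eq_sharp]
  rcases c with c | c
  · exact (hF.map_lmulL (.inl c) (.inl A1.one) rfl).trans (by rw [hF.map_unit (.inl A1.one) rfl])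
  · exact (hF.map_lmulL (.inr c) (.inr A2.one) rfl).trans (by rw [hF.map_unit (.inr A2.one) rfl])

lemma lfold_push : lfold G F (push A1 A2 r x) y = lfold G F r (G.l (F x) y) := by
  by_cases hu : unitL A1 A2 x
  · rw [push_unit hu, hF.map_unit x hu, G.one_l]
  rcases List.eq_nil_or_concat' r with rfl | ⟨t, d, rfl⟩
  · rw [push_nil hu]; rfl
  by_cases hs : sameF d x
  · have hm : G.l (F (lmulL A1 A2 d x)) y = G.l (F d) (G.l (F x) y) := by
      rw [hF.map_lmulL d x hs, G.l_assoc]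
    rw [lfold_append]
    change _ = lfold G F t (G.l (F d) (G.l (F x) y))
    rw [← hm]
    by_cases hu' : unitL A1 A2 (lmulL A1 A2 d x)
    · rw [push_concat_cancel hu hs hu', hF.map_unit _ hu', G.one_l]
    · rw [push_concat_mul hu hs hu', lfold_append]; rfl
  · rw [push_concat_of_not_sameF hu hs, lfold_append, lfold_append]; rfl

lemma rfold_push : rfold G F y (push A1 A2 r x) = G.r (rfold G F y r) (F x) := by
  by_cases hu : unitL A1 A2 x
  · rw [push_unit hu, hF.map_unit x hu, G.r_one]
  rcases List.eq_nil_or_concat' r with rfl | ⟨t, d, rfl⟩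
  · rw [push_nil hu]; rfl
  by_cases hs : sameF d x
  · have hm : G.r (rfold G F y t) (F (lmulL A1 A2 d x)) =
        G.r (G.r (rfold G F y t) (F d)) (F x) := by
      rw [hF.map_lmulL d x hs, G.ax1, G.r_assoc]
    rw [rfold_append]
    change _ = G.r (G.r (rfold G F y t) (F d)) (F x)
    rw [← hm]
    by_cases hu' : unitL A1 A2 (lmulL A1 A2 d x)
    · rw [push_concat_cancel hu hs hu', hF.map_unit _ hu', G.r_one]
    · rw [push_concat_mul hu hs hu', rfold_append]; rfl
  · rw [push_concat_of_not_sameF hu hs, rfold_append, rfold_append]; rfl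

lemma lfold_hatW : lfold G F (hatW A1 A2 w) y = lfold G F w y := by
  induction w using List.reverseRecOn generalizing y with
  | nil => rfl
  | append_singleton w x ih =>
    rw [hatW_concat, hF.lfold_push, ih, lfold_append, hF.map_tauL, G.l_assoc, G.one_l]; rfl

lemma rfold_hatW : rfold G F y (hatW A1 A2 w) = rfold G F y w := by
  induction w using List.reverseRecOn with
  | nil => rfl
  | append_singleton w x ih =>
    rw [hatW_concat, hF.rfold_push, ih, rfold_append, hF.map_tauL, G.ax1, G.r_one]; rfl

lemma lfold_toRep : lfold G F (toRep A1 w) y = lfold G F w y := by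
  rw [← hF.lfold_hatW, hatW_toRep, hF.lfold_hatW]

lemma rfold_toRep : rfold G F y (toRep A1 w) = rfold G F y w := by
  rw [← hF.rfold_hatW, hatW_toRep, hF.rfold_hatW]

lemma lfold_absorbL :
    lfold G F (absorbL A1 A2 r x).1 (F (absorbL A1 A2 r x).2) = lfold G F r (F x) := by
  rcases List.eq_nil_or_concat' r with rfl | ⟨t, d, rfl⟩
  · rfl
  by_cases hs : sameF d x
  · rw [absorbL_concat_of_sameF hs, hF.map_lmulL d x hs, lfold_append]; rfl
  · rw [absorbL_concat_of_not_sameF hs]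

lemma rfold_absorbR :
    rfold G F (F (absorbR A1 A2 x r).1) (absorbR A1 A2 x r).2 = rfold G F (F x) r := by
  rcases r with _ | ⟨d, t⟩
  · rfl
  by_cases hs : sameF x d
  · rw [absorbR_cons_of_sameF hs, hF.map_rmulL x d hs]; rfl
  · rw [absorbR_cons_of_not_sameF hs]

lemma wordValue_word (hw : Red A1 A2 w) :
    wordValue A1 G F (toRep A1 w, 1) = lfold G F w G.one := by
  rcases w with _ | ⟨c, t⟩
  · exact hF.map_unit (.inl A1.one) rfl
  · rw [lfold_one]
    change rfold G F (F c) t = rfold G F (G.r G.one (F c)) t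
    rw [G.one_r, ← hF.map_tauL, tauL_of_inJ (red_cons.1 hw).1.2]

lemma wordValue_l (hz : InOmega A1 A2 z) : G.l (wordValue A1 G F z) y = lfold G F z.1 y := by
  rcases hz.cases with ⟨w, hw, rfl⟩ | ⟨p, x, q, -, -, -, rfl⟩
  · rw [hF.wordValue_word hw, lfold_l, G.one_l, hF.lfold_toRep]
  · rw [wordValue_mid, rfold_l, lfold_l, lfold_append]; rfl

lemma r_wordValue (hz : InOmega A1 A2 z) : G.r y (wordValue A1 G F z) = rfold G F y z.1 := by
  rcases hz.cases with ⟨w, hw, rfl⟩ | ⟨p, x, q, -, -, -, rfl⟩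
  · rw [hF.wordValue_word hw, r_lfold, G.r_one, hF.rfold_toRep]
  · rw [wordValue_mid, r_rfold, r_lfold, rfold_append]; rfl

lemma wordValue_opLspec (hz : InOmega A1 A2 z) (hz' : InOmega A1 A2 z') :
    wordValue A1 G F (opLspec A1 A2 z z') = G.l (wordValue A1 G F z) (wordValue A1 G F z') := by
  rw [hF.wordValue_l hz]
  rcases hz'.cases with ⟨w, hw, rfl⟩ | ⟨p, x, q, hx, -, -, rfl⟩
  · rw [opLspec_word hw, hF.wordValue_word red_hatW, hF.wordValue_word hw, hF.lfold_hatW,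
      lfold_append]
  · rw [opLspec_mid hx, wordValue_mid, wordValue_mid, hF.lfold_absorbL, hF.lfold_hatW,
      lfold_append, lfold_rfold]

lemma wordValue_opRspec (hz : InOmega A1 A2 z) (hz' : InOmega A1 A2 z') :
    wordValue A1 G F (opRspec A1 A2 z z') = G.r (wordValue A1 G F z) (wordValue A1 G F z') := by
  rw [hF.r_wordValue hz']
  rcases hz.cases with ⟨w, hw, rfl⟩ | ⟨p, x, q, hx, -, -, rfl⟩
  · rw [opRspec_word hw, hF.wordValue_word red_hatW, hF.wordValue_word hw, hF.lfold_hatW,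
      lfold_one, lfold_one, rfold_append]
  · rw [opRspec_mid hx, wordValue_mid, wordValue_mid, ← lfold_rfold, hF.rfold_absorbR,
      hF.rfold_hatW, rfold_append, lfold_rfold, lfold_rfold]

lemma isDigroupHom_wordValue :
    IsDigroupHom (omegaDigroup A1 A2) G (fun z => wordValue A1 G F z.1) :=
  ⟨fun a b => hF.wordValue_opLspec a.2 b.2, fun a b => hF.wordValue_opRspec a.2 b.2,
    hF.wordValue_word red_nil⟩

end IsLetterHom

end Extension

section Embedding

variable {D1 D2 : Type} {A1 : DigroupStruct D1} {A2 : DigroupStruct D2}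

lemma lmulL_tauL {c x : D1 ⊕ D2} (h : sameF c x) :
    lmulL A1 A2 (tauL A1 A2 c) x = lmulL A1 A2 c x := by
  rw [tauL_eq_sharp]
  rcases c with c | c <;> rcases x with x | x <;>
    simp_all [sameF, sharp, lmulL, DisemigroupStruct.l_assoc, DigroupStruct.one_l]

lemma rmulL_tauL {c x : D1 ⊕ D2} (h : sameF x c) :
    rmulL A1 A2 x (tauL A1 A2 c) = rmulL A1 A2 x c := by
  rw [tauL_eq_sharp]
  rcases c with c | c <;> rcases x with x | x <;>
    simp_all [sameF, sharp, rmulL, DisemigroupStruct.ax1, DigroupStruct.r_one]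

lemma redBefore_nil {x : D1 ⊕ D2} : RedBefore A1 A2 [] x := ⟨red_nil, by simp⟩

lemma redAfter_nil {x : D1 ⊕ D2} : RedAfter A1 A2 x [] := ⟨red_nil, by simp⟩

lemma hatW_singleton_of_inJ {c : D1 ⊕ D2} (h : inJ A1 A2 c) :
    hatW A1 A2 [c] = if unitL A1 A2 c then [] else [c] := by
  split_ifs with hu
  · exact hatW_cons_unit red_nil hu
  · exact hatW_of_red (red_singleton.2 ⟨hu, h⟩)

variable (A1 A2)

/-- The representative in `Ω` of a single letter. -/
noncomputable def letterRep (c : D1 ⊕ D2) : List (D1 ⊕ D2) × ℕ :=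
  if inJ A1 A2 c then (toRep A1 (hatW A1 A2 [c]), 1) else ([c], 1)

/-- The natural embedding of letters in `Ω`. -/
noncomputable def letterEmb (c : D1 ⊕ D2) : Omega A1 A2 :=
  ⟨letterRep A1 A2 c, by
    unfold letterRep
    split_ifs with h
    · exact inOmega_toRep red_hatW
    · exact inOmega_mid (p := []) h redBefore_nil redAfter_nil⟩

variable {A1 A2}
variable {c x : D1 ⊕ D2} {z : List (D1 ⊕ D2) × ℕ}

lemma letterRep_of_not_unitL (h : ¬ unitL A1 A2 c) : letterRep A1 A2 c = ([c], 1) := by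
  unfold letterRep
  split_ifs with hc
  · rw [hatW_singleton_of_inJ hc, if_neg h]
    rfl
  · rfl

lemma letterRep_of_unitL (h : unitL A1 A2 c) : letterRep A1 A2 c = (toRep A1 [], 1) := by
  rw [letterRep, if_pos (inJ_of_unitL h), hatW_singleton_of_inJ (inJ_of_unitL h), if_pos h]

lemma hatW_letterRep : hatW A1 A2 (letterRep A1 A2 c).1 = hatW A1 A2 [c] := by
  unfold letterRep
  split_ifs with hc
  · rw [hatW_toRep, hatW_hatW]
  · rfl

lemma letterRep_lmulL (h : sameF c x) :
    letterRep A1 A2 (lmulL A1 A2 c x) = opLspec A1 A2 (letterRep A1 A2 c) (letterRep A1 A2 x) := by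
  by_cases hx : inJ A1 A2 x
  · rw [letterRep, if_pos ((inJ_lmulL_iff h).2 hx), letterRep.eq_def A1 A2 x, if_pos hx,
      opLspec_word red_hatW, hatW_append_hatW, hatW_append_congr hatW_letterRep rfl, hatW_lmulL h]
    rfl
  · rw [letterRep, if_neg (mt (inJ_lmulL_iff h).1 hx), letterRep.eq_def A1 A2 x, if_neg hx]
    have := opLspec_mid (z := letterRep A1 A2 c) (p := []) (q := []) hx
    rw [List.append_nil, hatW_letterRep] at this
    have ha : absorbL A1 A2 (hatW A1 A2 [c]) x = ([], lmulL A1 A2 c x) := by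
      rw [← lmulL_tauL h]
      exact absorbL_push red_nil (sameF_tauL_left.2 h)
    rw [ha] at this
    exact this.symm

lemma letterRep_rmulL (h : sameF x c) :
    letterRep A1 A2 (rmulL A1 A2 x c) = opRspec A1 A2 (letterRep A1 A2 x) (letterRep A1 A2 c) := by
  by_cases hx : inJ A1 A2 x
  · rw [letterRep, if_pos (inJ_rmulL_iff.2 hx), letterRep.eq_def A1 A2 x, if_pos hx,
      opRspec_word red_hatW, hatW_hatW_append, hatW_append_congr rfl hatW_letterRep, hatW_rmulL h]
    rfl
  · rw [letterRep, if_neg (mt inJ_rmulL_iff.1 hx), letterRep.eq_def A1 A2 x, if_neg hx]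
    have := opRspec_mid (z := letterRep A1 A2 c) (p := []) (q := []) hx
    rw [List.nil_append (letterRep A1 A2 c).1, hatW_letterRep] at this
    have ha : absorbR A1 A2 x (hatW A1 A2 [c]) = (rmulL A1 A2 x c, []) := by
      have hc : hatW A1 A2 [c] = hatW A1 A2 [tauL A1 A2 c] := by
        change push A1 A2 [] _ = push A1 A2 [] _
        rw [tauL_of_inJ (inJ_tauL c)]
      rw [← rmulL_tauL h, hc]
      exact absorbR_hatW_cons red_nil (inJ_tauL c) (sameF_tauL_right.2 h)
    rw [ha] at this
    exact this.symm

lemma isLetterHom_letterEmb : IsLetterHom A1 A2 (omegaDigroup A1 A2) (letterEmb A1 A2) where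
  map_lmulL _ _ h := Subtype.ext (letterRep_lmulL h)
  map_rmulL _ _ h := Subtype.ext (letterRep_rmulL h)
  map_unit _ h := Subtype.ext (letterRep_of_unitL h)

lemma val_lfold_letterEmb (w : List (D1 ⊕ D2)) (z : Omega A1 A2) :
    (lfold (omegaDigroup A1 A2) (letterEmb A1 A2) w z).1 = opLspec A1 A2 (w, 0) z.1 := by
  induction w with
  | nil => exact (opLspec_nil z.2 0).symm
  | cons c w ih =>
    change opLspec A1 A2 (letterRep A1 A2 c) (lfold _ _ w z).1 = _
    rw [ih, opLspec_congr (z₂ := ([c], 0)) hatW_letterRep (inOmega_opLspec z.2)]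
    exact (opLspec_append z.2 0 0 0).symm

lemma val_rfold_letterEmb (w : List (D1 ⊕ D2)) (z : Omega A1 A2) :
    (rfold (omegaDigroup A1 A2) (letterEmb A1 A2) z w).1 = opRspec A1 A2 z.1 (w, 0) := by
  induction w using List.reverseRecOn with
  | nil => exact (opRspec_nil z.2 0).symm
  | append_singleton w c ih =>
    rw [rfold_append]
    change opRspec A1 A2 (rfold _ _ z w).1 (letterRep A1 A2 c) = _
    rw [ih, opRspec_congr (z₂ := ([c], 0)) hatW_letterRep (inOmega_opRspec z.2)]
    exact (opRspec_append z.2 0 0 0).symm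

lemma wordValue_letterEmb (z : Omega A1 A2) :
    wordValue A1 (omegaDigroup A1 A2) (letterEmb A1 A2) z.1 = z := by
  apply Subtype.ext
  rcases z.2.cases with ⟨w, hw, hz⟩ | ⟨p, x, q, hx, hp, hq, hz⟩
  · rw [hz, isLetterHom_letterEmb.wordValue_word hw, val_lfold_letterEmb]
    refine (opLspec_word red_nil).trans ?_
    rw [List.append_nil, hatW_of_red hw]
  · rw [hz, wordValue_mid, val_rfold_letterEmb, val_lfold_letterEmb]
    have hl : opLspec A1 A2 (p, 0) (letterEmb A1 A2 x).1 = (p ++ [x], p.length + 1) := by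
      change opLspec A1 A2 (p, 0) (letterRep A1 A2 x) = _
      rw [letterRep, if_neg hx]
      have := opLspec_mid (z := (p, 0)) (p := []) (q := []) hx
      rwa [List.append_nil, hatW_of_red hp.1, absorbL_of_redBefore hp] at this
    rw [hl, opRspec_mid hx, List.nil_append, hatW_of_red hq.1, absorbR_of_redAfter hq]

lemma IsDigroupHom.apply_eq_wordValue {C : Type} {G : DigroupStruct C} {ψ : Omega A1 A2 → C}
    (h : IsDigroupHom (omegaDigroup A1 A2) G ψ) (z : Omega A1 A2) :
    ψ z = wordValue A1 G (ψ ∘ letterEmb A1 A2) z.1 := by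
  conv_lhs => rw [← wordValue_letterEmb z]
  rw [wordValue, h.map_rfold, h.map_lfold]
  rfl

lemma wordValue_letterRep {C : Type} {G : DigroupStruct C} {F : D1 ⊕ D2 → C}
    (hF : IsLetterHom A1 A2 G F) (c : D1 ⊕ D2) : wordValue A1 G F (letterRep A1 A2 c) = F c := by
  by_cases hu : unitL A1 A2 c
  · rw [letterRep_of_unitL hu, hF.wordValue_word red_nil, hF.map_unit c hu]
    rfl
  · rw [letterRep_of_not_unitL hu]
    rfl

lemma isFreeProduct_omegaDigroup : IsFreeProduct A1 A2 (omegaDigroup A1 A2)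
    (letterEmb A1 A2 ∘ Sum.inl) (letterEmb A1 A2 ∘ Sum.inr) := by
  refine ⟨⟨fun a b => isLetterHom_letterEmb.map_lmulL (.inl a) (.inl b) rfl,
      fun a b => isLetterHom_letterEmb.map_rmulL (.inl a) (.inl b) rfl,
      isLetterHom_letterEmb.map_unit (.inl A1.one) rfl⟩,
    ⟨fun a b => isLetterHom_letterEmb.map_lmulL (.inr a) (.inr b) rfl,
      fun a b => isLetterHom_letterEmb.map_rmulL (.inr a) (.inr b) rfl,
      isLetterHom_letterEmb.map_unit (.inr A2.one) rfl⟩, ?_⟩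
  intro C G f1 f2 h1 h2
  have hF := isLetterHom_elim h1 h2
  refine ⟨fun z => wordValue A1 G (Sum.elim f1 f2) z.1, ⟨hF.isDigroupHom_wordValue,
    funext fun a => wordValue_letterRep hF (.inl a),
    funext fun a => wordValue_letterRep hF (.inr a)⟩, ?_⟩
  rintro ψ ⟨hψ, hψ1, hψ2⟩
  have he : ψ ∘ letterEmb A1 A2 = Sum.elim f1 f2 := by
    funext c
    rcases c with a | a
    · exact congrFun hψ1 a
    · exact congrFun hψ2 a
  funext z
  rw [hψ.apply_eq_wordValue, he]

end Embedding

/-- The digroup `Ω = Ω₁ ∪ Ω₂`, together with the natural embeddings of `A₁` and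
`A₂`, is a free product of the digroups `(A₁,e₁)` and `(A₂,e₂)`. -/
theorem omega_is_freeProduct {D1 D2 : Type}
    (A1 : DigroupStruct D1) (A2 : DigroupStruct D2) :
    ∃ (Q : DigroupStruct (Omega A1 A2)) (g1 : D1 → Omega A1 A2)
      (g2 : D2 → Omega A1 A2),
      Q.one.val = ([Sum.inl A1.one], 1) ∧
      (∀ z z' : Omega A1 A2, (Q.l z z').val = opLspec A1 A2 z.val z'.val) ∧
      (∀ z z' : Omega A1 A2, (Q.r z z').val = opRspec A1 A2 z.val z'.val) ∧
      (∀ a : D1, (g1 a).val = ([Sum.inl a], 1)) ∧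
      (∀ a : D2, a ≠ A2.one → (g2 a).val = ([Sum.inr a], 1)) ∧
      (g2 A2.one).val = ([Sum.inl A1.one], 1) ∧
      IsFreeProduct A1 A2 Q g1 g2 := by
  refine ⟨omegaDigroup A1 A2, letterEmb A1 A2 ∘ Sum.inl, letterEmb A1 A2 ∘ Sum.inr, rfl,
    fun _ _ => rfl, fun _ _ => rfl, fun a => ?_, fun a ha => letterRep_of_not_unitL ha,
    letterRep_of_unitL (c := .inr A2.one) rfl, isFreeProduct_omegaDigroup⟩
  by_cases ha : a = A1.one
  · subst ha
    exact letterRep_of_unitL (c := .inl A1.one) rfl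
  · exact letterRep_of_not_unitL (c := .inl a) ha
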